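/- Let c₀ > 0, c > 0, R, V, d₁ ∈ ℝ, M ≥ 1, and let A_1, …, A_M ∈ ℝ, η_1, …, η_M ∈ ℝ, and κ_1, …, κ_M > 0 be pairwise distinct with c κ_i = 2 c₀ sin(κ_i/2). Define 𝓡(φ) = R + Σ_{i=1}^M A_i cos(κ_i φ + κ_i/2 + η_i) and 𝓥(φ) = V − c₀ Σ_{i=1}^M A_i cos(κ_i φ + η_i). Then the radiation flux satisfies Q := lim_{L→∞} −(1/(2L)) ∫_{−L}^{L} (𝓥(φ) − V)( c₀² 𝓡(φ) + d₁ ) dφ = ½ c₀³ Σ_{i=1}^M A_i² cos(κ_i/2). In particular, for M = 1 one has Q = c_gr · E_osc, where c_gr = c₀ cos(κ_1/2) is the group speed Ω′(κ_1) of the dispersion relation Ω(k) = 2 c₀ sin(k/2) and E_osc = ½ c₀² A_1². -/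

import Mathlib

open Filter intervalIntegral

/-- The continuous function `f` has mean value `m` over the symmetric intervals `[-L, L]`
as `L → ∞`. -/
def HasMean (f : ℝ → ℝ) (m : ℝ) : Prop :=
  Continuous f ∧
    Tendsto (fun L : ℝ => (1 / (2 * L)) * ∫ φ in (-L)..L, f φ) atTop (nhds m)

namespace HasMean

theorem const (a : ℝ) : HasMean (fun _ => a) a := by
  refine ⟨continuous_const, tendsto_const_nhds.congr' ?_⟩
  filter_upwards [eventually_gt_atTop 0] with L hL
  rw [intervalIntegral.integral_const, smul_eq_mul]
  field_simp
  ring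

theorem add {f g : ℝ → ℝ} {m n : ℝ} (hf : HasMean f m) (hg : HasMean g n) :
    HasMean (fun φ => f φ + g φ) (m + n) := by
  refine ⟨hf.1.add hg.1, (hf.2.add hg.2).congr fun L => ?_⟩
  rw [intervalIntegral.integral_add (hf.1.intervalIntegrable _ _) (hg.1.intervalIntegrable _ _),
    mul_add]

theorem const_mul {f : ℝ → ℝ} {m : ℝ} (a : ℝ) (hf : HasMean f m) :
    HasMean (fun φ => a * f φ) (a * m) := by
  refine ⟨continuous_const.mul hf.1, (hf.2.const_mul a).congr fun L => ?_⟩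
  rw [intervalIntegral.integral_const_mul]
  ring

theorem sum {ι : Type*} (s : Finset ι) {f : ι → ℝ → ℝ} {m : ι → ℝ}
    (hf : ∀ i ∈ s, HasMean (f i) (m i)) :
    HasMean (fun φ => ∑ i ∈ s, f i φ) (∑ i ∈ s, m i) := by
  classical
  induction s using Finset.induction_on with
  | empty => simpa using const 0
  | insert a s ha ih =>
    simp only [Finset.sum_insert ha]
    exact (hf a (Finset.mem_insert_self a s)).add
      (ih fun i hi => hf i (Finset.mem_insert_of_mem hi))

theorem cos_affine {k : ℝ} (hk : k ≠ 0) (b : ℝ) :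
    HasMean (fun φ => Real.cos (k * φ + b)) 0 := by
  refine ⟨by fun_prop, ?_⟩
  have hint : ∀ L : ℝ, ∫ φ in (-L)..L, Real.cos (k * φ + b)
      = k⁻¹ * (Real.sin (k * L + b) - Real.sin (k * -L + b)) := fun L => by
    rw [intervalIntegral.integral_comp_mul_add (fun x => Real.cos x) hk b, integral_cos,
      smul_eq_mul]
  have hlim : Tendsto (fun L : ℝ => |k⁻¹| * L⁻¹) atTop (nhds 0) := by
    simpa using tendsto_inv_atTop_zero.const_mul |k⁻¹|
  refine squeeze_zero_norm' ?_ hlim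
  filter_upwards [eventually_gt_atTop 0] with L hL
  have hsin : |Real.sin (k * L + b) - Real.sin (k * -L + b)| ≤ 2 :=
    abs_le.mpr ⟨by linarith [Real.neg_one_le_sin (k * L + b), Real.sin_le_one (k * -L + b)],
      by linarith [Real.sin_le_one (k * L + b), Real.neg_one_le_sin (k * -L + b)]⟩
  rw [hint, Real.norm_eq_abs, abs_mul, abs_mul, abs_of_pos (by positivity : 0 < 1 / (2 * L))]
  calc 1 / (2 * L) * (|k⁻¹| * |Real.sin (k * L + b) - Real.sin (k * -L + b)|)
      ≤ 1 / (2 * L) * (|k⁻¹| * 2) := by gcongr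
    _ = |k⁻¹| * L⁻¹ := by field_simp

theorem cos_mul_cos_of_ne {k l : ℝ} (hk : 0 < k) (hl : 0 < l) (hkl : k ≠ l) (a b : ℝ) :
    HasMean (fun φ => Real.cos (k * φ + a) * Real.cos (l * φ + b)) 0 := by
  have h := ((cos_affine (sub_ne_zero.mpr hkl) (a - b)).add
    (cos_affine (add_pos hk hl).ne' (a + b))).const_mul (1 / 2)
  convert h using 2 with φ
  · rw [show (k - l) * φ + (a - b) = (k * φ + a) - (l * φ + b) by ring,
      show (k + l) * φ + (a + b) = (k * φ + a) + (l * φ + b) by ring,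
      Real.cos_sub, Real.cos_add (k * φ + a)]
    ring
  · ring

theorem cos_mul_cos_self {k : ℝ} (hk : 0 < k) (a b : ℝ) :
    HasMean (fun φ => Real.cos (k * φ + a) * Real.cos (k * φ + b))
      (1 / 2 * Real.cos (a - b)) := by
  have h := ((const (Real.cos (a - b))).add
    (cos_affine (add_pos hk hk).ne' (a + b))).const_mul (1 / 2)
  convert h using 2 with φ
  · rw [show a - b = (k * φ + a) - (k * φ + b) by ring,
      show (k + k) * φ + (a + b) = (k * φ + a) + (k * φ + b) by ring,
      Real.cos_sub, Real.cos_add (k * φ + a)]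
    ring
  · ring

end HasMean

/-- Radiation flux of a harmonic travelling wave:
`Q = −⟨(v − V) Φ′(r)⟩ = ½ c₀³ Σ A_i² cos(κ_i/2)`; in particular for `M = 1`
one has `Q = c_gr · E_osc` with `c_gr = c₀ cos(κ₁/2)` and `E_osc = ½ c₀² A₁²`. -/
theorem harmonic_wave_radiation_flux
    (c₀ c R V d₁ : ℝ) (hc₀ : 0 < c₀) (hc : 0 < c)
    (M : ℕ) (hM : 1 ≤ M) (A η κ : Fin M → ℝ) (hκ : ∀ i, 0 < κ i)
    (hinj : Function.Injective κ)
    (hdisp : ∀ i, c * κ i = 2 * c₀ * Real.sin (κ i / 2))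
    (𝓡 𝓥 : ℝ → ℝ)
    (h𝓡 : ∀ φ : ℝ, 𝓡 φ = R + ∑ i, A i * Real.cos (κ i * φ + κ i / 2 + η i))
    (h𝓥 : ∀ φ : ℝ, 𝓥 φ = V - c₀ * ∑ i, A i * Real.cos (κ i * φ + η i)) :
    Tendsto (fun L : ℝ =>
        -((1 / (2 * L)) * ∫ φ in (-L)..L, (𝓥 φ - V) * (c₀ ^ 2 * 𝓡 φ + d₁)))
      atTop (nhds ((1 / 2) * c₀ ^ 3 * ∑ i, (A i) ^ 2 * Real.cos (κ i / 2))) ∧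
    (M = 1 → ∀ i : Fin M,
      Tendsto (fun L : ℝ =>
          -((1 / (2 * L)) * ∫ φ in (-L)..L, (𝓥 φ - V) * (c₀ ^ 2 * 𝓡 φ + d₁)))
        atTop
        (nhds ((c₀ * Real.cos (κ i / 2)) * ((1 / 2) * c₀ ^ 2 * (A i) ^ 2)))) := by
  have hpair : ∀ i j : Fin M,
      HasMean (fun φ => A i * A j *
          (Real.cos (κ i * φ + η i) * Real.cos (κ j * φ + (κ j / 2 + η j))))
        (if i = j then A i ^ 2 * (1 / 2 * Real.cos (κ i / 2)) else 0) := by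
    intro i j
    split_ifs with hij
    · subst hij
      convert (HasMean.cos_mul_cos_self (hκ i) (η i) (κ i / 2 + η i)).const_mul (A i * A i) using 1
      rw [show η i - (κ i / 2 + η i) = -(κ i / 2) by ring, Real.cos_neg]
      ring
    · simpa using (HasMean.cos_mul_cos_of_ne (hκ i) (hκ j) (hinj.ne hij) (η i)
        (κ j / 2 + η j)).const_mul (A i * A j)
  have hlin := HasMean.sum Finset.univ fun i _ =>
    (HasMean.cos_affine (hκ i).ne' (η i)).const_mul (A i)
  have hquad := HasMean.sum Finset.univ fun i _ =>
    HasMean.sum Finset.univ fun j _ => hpair i j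
  have hmean := (hlin.const_mul (-c₀ * (c₀ ^ 2 * R + d₁))).add (hquad.const_mul (-c₀ ^ 3))
  have hflux : Tendsto (fun L : ℝ =>
      -((1 / (2 * L)) * ∫ φ in (-L)..L, (𝓥 φ - V) * (c₀ ^ 2 * 𝓡 φ + d₁)))
      atTop (nhds ((1 / 2) * c₀ ^ 3 * ∑ i, (A i) ^ 2 * Real.cos (κ i / 2))) := by
    convert hmean.2.neg using 1
    · funext L
      congr 3
      funext φ
      have hprod : ∑ i, ∑ j, A i * A j *
            (Real.cos (κ i * φ + η i) * Real.cos (κ j * φ + (κ j / 2 + η j)))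
          = (∑ i, A i * Real.cos (κ i * φ + η i)) *
            ∑ j, A j * Real.cos (κ j * φ + κ j / 2 + η j) := by
        rw [Finset.sum_mul_sum]
        refine Finset.sum_congr rfl fun i _ => Finset.sum_congr rfl fun j _ => ?_
        rw [← add_assoc]
        ring
      beta_reduce
      rw [hprod, h𝓡, h𝓥]
      ring
    · congr 1
      simp only [Finset.sum_ite_eq, Finset.mem_univ, if_true, mul_zero, Finset.sum_const_zero,
        zero_add, Finset.mul_sum, ← Finset.sum_neg_distrib]
      exact Finset.sum_congr rfl fun i _ => by ring
  refine ⟨hflux, fun hM1 i => ?_⟩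
  subst hM1
  convert hflux using 2
  rw [Fin.sum_univ_one, Subsingleton.elim i 0]
  ring
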